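/- arXiv:1211.3324 — 7 statements merged into one kernel-verified Lean document; each statement's English description precedes it below -/
import Mathlib

section
/- Let A and B be m×m real matrices with spectral radius sp(A) < 1. Then there exists r > 1 such that the series ∑_{n≥0} ‖Pₙ(A,B)‖ · rⁿ converges; in particular, for every complex (or real) z with |z| ≤ 1 the series P(z;A,B) = ∑_{n≥0} zⁿ Pₙ(A,B) converges absolutely. -/
open Matrix

attribute [local instance] Matrix.linftyOpNormedAddCommGroup Matrix.linftyOpNormedRing

/-- `Pmat A B n = ∏_{i=1}^{n} (A + (1/i) B)`. -/
noncomputable def Pmat {m : ℕ} (A B : Matrix (Fin m) (Fin m) ℝ) :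
    ℕ → Matrix (Fin m) (Fin m) ℝ
  | 0 => 1
  | k + 1 => Pmat A B k * (A + ((k + 1 : ℕ) : ℝ)⁻¹ • B)

open Filter Topology

/-- A nonnegative sequence that eventually contracts by a fixed factor `c < 1` under the shift by
`p` is summable. -/
theorem summable_of_eventually_shift_le {a : ℕ → ℝ} (ha : ∀ n, 0 ≤ a n) {c : ℝ} (hc : c < 1)
    (p : ℕ) (h : ∀ᶠ n in atTop, a (n + p) ≤ c * a n) : Summable a := by
  obtain ⟨N, hN⟩ := eventually_atTop.1 h
  rw [← summable_nat_add_iff N]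
  refine summable_of_sum_range_le (c := (∑ n ∈ Finset.range p, a (n + N)) / (1 - c))
    (fun n => ha _) fun M => ?_
  rw [le_div_iff₀ (by linarith)]
  have hmono : ∑ n ∈ Finset.range M, a (n + N) ≤ ∑ n ∈ Finset.range (p + M), a (n + N) :=
    Finset.sum_le_sum_of_subset_of_nonneg (Finset.range_mono (by omega)) fun _ _ _ => ha _
  have hshift : ∑ n ∈ Finset.range M, a (p + n + N) ≤ c * ∑ n ∈ Finset.range M, a (n + N) := by
    rw [Finset.mul_sum]
    refine Finset.sum_le_sum fun n _ => ?_
    have := hN (n + N) (by omega)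
    rwa [show n + N + p = p + n + N by ring] at this
  rw [Finset.sum_range_add] at hmono
  linarith

section NormedRing

variable {R : Type*} [NormedRing R] {P M : ℕ → R} {A : R}

/-- Blocks of `p` consecutive factors of a product whose factors tend to `A` tend to `A ^ p`. -/
theorem exists_tendsto_pow_of_succ_eq_mul (hP : ∀ n, P (n + 1) = P n * M n)
    (hM : Tendsto M atTop (𝓝 A)) (p : ℕ) :
    ∃ Q : ℕ → R, Tendsto Q atTop (𝓝 (A ^ p)) ∧ ∀ n, P (n + p) = P n * Q n := by
  induction p with
  | zero => exact ⟨fun _ => 1, by simp, by simp⟩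
  | succ p ih =>
    obtain ⟨Q, hQ, hPQ⟩ := ih
    refine ⟨fun n => Q n * M (n + p), ?_, fun n => ?_⟩
    · rw [pow_succ]
      exact hQ.mul (hM.comp (tendsto_add_atTop_nat p))
    · rw [← add_assoc, hP, hPQ, mul_assoc]

/-- A product whose factors tend to `A`, where some power of `A` has norm less than one, decays
exponentially. -/
theorem exists_summable_norm_mul_pow_of_succ_eq_mul (hP : ∀ n, P (n + 1) = P n * M n)
    (hM : Tendsto M atTop (𝓝 A)) {p : ℕ} (hp : ‖A ^ p‖ < 1) :
    ∃ r : ℝ, 1 < r ∧ Summable fun n => ‖P n‖ * r ^ n := by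
  obtain ⟨Q, hQ, hPQ⟩ := exists_tendsto_pow_of_succ_eq_mul hP hM p
  obtain ⟨q, hq, hq1⟩ := exists_between hp
  have hr : ∀ᶠ r : ℝ in 𝓝[>] 1, q * r ^ p < 1 := by
    have hcont : Continuous fun r : ℝ => q * r ^ p := by fun_prop
    exact nhdsWithin_le_nhds (hcont.continuousAt.eventually_lt_const (by simpa using hq1))
  obtain ⟨r, hrq, hr1 : 1 < r⟩ := (hr.and self_mem_nhdsWithin).exists
  have hr0 : 0 < r := by linarith
  refine ⟨r, hr1, summable_of_eventually_shift_le (fun n => by positivity) hrq p ?_⟩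
  filter_upwards [hQ.norm.eventually_lt_const hq] with n hn
  calc ‖P (n + p)‖ * r ^ (n + p) ≤ ‖P n‖ * q * r ^ (n + p) := by
        rw [hPQ]
        gcongr
        exact (norm_mul_le _ _).trans (by gcongr)
    _ = q * r ^ p * (‖P n‖ * r ^ n) := by ring

end NormedRing

/-- By Gelfand's formula, an element of spectral radius less than one has a power of norm less than
one. -/
theorem exists_norm_pow_lt_one_of_spectralRadius_lt_one {R : Type*} [NormedRing R]
    [NormedAlgebra ℂ R] [CompleteSpace R] {a : R} (ha : spectralRadius ℂ a < 1) :
    ∃ p : ℕ, ‖a ^ p‖ < 1 := by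
  have h := (spectrum.pow_nnnorm_pow_one_div_tendsto_nhds_spectralRadius a).eventually_lt_const ha
  obtain ⟨p, hp, hp0⟩ := (h.and (eventually_gt_atTop 0)).exists
  refine ⟨p, ?_⟩
  by_contra! hle
  refine hp.not_ge (ENNReal.one_le_rpow ?_ (by positivity))
  exact_mod_cast hle

attribute [local instance] Matrix.linftyOpNormedAlgebra

theorem Matrix.linfty_opNorm_map_algebraMap {m : Type*} [Fintype m] (A : Matrix m m ℝ) :
    ‖A.map (algebraMap ℝ ℂ)‖ = ‖A‖ := by
  simp [Matrix.linfty_opNorm_def]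

theorem Matrix.exists_norm_pow_lt_one_of_spectralRadius_lt_one {m : Type*} [Fintype m]
    [DecidableEq m] {A : Matrix m m ℝ}
    (hA : spectralRadius ℂ (A.map (algebraMap ℝ ℂ)) < 1) : ∃ p : ℕ, ‖A ^ p‖ < 1 := by
  have : CompleteSpace (Matrix m m ℂ) := FiniteDimensional.complete ℂ _
  obtain ⟨p, hp⟩ := _root_.exists_norm_pow_lt_one_of_spectralRadius_lt_one hA
  refine ⟨p, ?_⟩
  rwa [← Matrix.map_pow, Matrix.linfty_opNorm_map_algebraMap] at hp

/-- If `sp(A) < 1` then the power series `∑ zⁿ Pₙ(A,B)` has radius of convergence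
larger than `1`: there is `r > 1` with `∑ ‖Pₙ‖ rⁿ < ∞`; in particular the series
converges absolutely for every `z` with `|z| ≤ 1`. -/
theorem summable_of_spectralRadius_lt_one {m : ℕ} (A B : Matrix (Fin m) (Fin m) ℝ)
    (hA : spectralRadius ℂ (A.map (algebraMap ℝ ℂ)) < 1) :
    (∃ r : ℝ, 1 < r ∧ Summable (fun n : ℕ => ‖Pmat A B n‖ * r ^ n)) ∧
      ∀ z : ℂ, ‖z‖ ≤ 1 → Summable (fun n : ℕ => ‖z‖ ^ n * ‖Pmat A B n‖) := by
  have hM : Tendsto (fun n : ℕ => A + ((n + 1 : ℕ) : ℝ)⁻¹ • B) atTop (𝓝 A) := by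
    have hinv : Tendsto (fun n : ℕ => ((n + 1 : ℕ) : ℝ)⁻¹) atTop (𝓝 0) :=
      (tendsto_inv_atTop_nhds_zero_nat (𝕜 := ℝ)).comp (tendsto_add_atTop_nat 1)
    simpa using (hinv.smul_const B).const_add A
  obtain ⟨p, hp⟩ := Matrix.exists_norm_pow_lt_one_of_spectralRadius_lt_one hA
  obtain ⟨r, hr, hsum⟩ :=
    exists_summable_norm_mul_pow_of_succ_eq_mul (P := Pmat A B) (fun _ => rfl) hM hp
  refine ⟨⟨r, hr, hsum⟩, fun z hz => hsum.of_nonneg_of_le (fun n => by positivity) fun n => ?_⟩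
  rw [mul_comm]
  gcongr
  exact hz.trans hr.le
end

section
/- Let A and B be m×m real matrices. For every ε > 0 there exists a constant C > 0 such that ‖Pₙ(A,B)‖ ≤ C · (sp(A) + ε)ⁿ for all n ≥ 0. Consequently, limsup_{n→∞} ‖Pₙ(A,B)‖^{1/n} ≤ sp(A). -/
open Matrix Filter

attribute [local instance] Matrix.linftyOpNormedAddCommGroup Matrix.linftyOpNormedRing

/-- A sequence whose ratios are eventually at most `σ` grows at most geometrically at rate `σ`. -/
theorem exists_le_mul_pow_of_eventually_succ_le {f : ℕ → ℝ} {σ : ℝ} (hσ : 0 < σ)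
    (h : ∀ᶠ n in atTop, f (n + 1) ≤ f n * σ) : ∃ C : ℝ, 0 < C ∧ ∀ n, f n ≤ C * σ ^ n := by
  obtain ⟨N, hN⟩ := eventually_atTop.1 h
  let C := 1 + ∑ n ∈ Finset.range (N + 1), |f n| / σ ^ n
  have hinit : ∀ n ≤ N, f n ≤ C * σ ^ n := fun n hn => by
    have hterm : |f n| / σ ^ n ≤ C :=
      (Finset.single_le_sum (f := fun n => |f n| / σ ^ n) (fun _ _ => by positivity)
        (Finset.mem_range.2 (Nat.lt_succ_of_le hn))).trans (le_add_of_nonneg_left zero_le_one)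
    exact (le_abs_self _).trans ((div_le_iff₀ (pow_pos hσ n)).1 hterm)
  refine ⟨C, by positivity, fun n => ?_⟩
  rcases le_total n N with hn | hn
  · exact hinit n hn
  · induction n, hn using Nat.le_induction with
    | base => exact hinit N le_rfl
    | succ k hk ih =>
      calc f (k + 1) ≤ f k * σ := hN k hk
        _ ≤ C * σ ^ k * σ := by gcongr
        _ = C * σ ^ (k + 1) := by ring

/-- By Gelfand's formula, the powers of `a` grow at most geometrically at any rate exceeding the
spectral radius. -/
theorem exists_norm_pow_le_mul_pow {R : Type*} [NormedRing R] [NormedAlgebra ℂ R]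
    [CompleteSpace R] (a : R) {ρ : ℝ} (hρ : (spectralRadius ℂ a).toReal < ρ) :
    ∃ K : ℝ, 0 < K ∧ ∀ n, ‖a ^ n‖ ≤ K * ρ ^ n := by
  have hρ0 : 0 < ρ := ENNReal.toReal_nonneg.trans_lt hρ
  have htop : spectralRadius ℂ a ≠ ⊤ := by
    refine ne_top_of_le_ne_top ?_ (spectrum.spectralRadius_le_pow_nnnorm_pow_one_div ℂ a 0)
    finiteness
  have hlt : spectralRadius ℂ a < ENNReal.ofReal ρ := by
    rwa [ENNReal.lt_ofReal_iff_toReal_lt htop]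
  have hev : ∀ᶠ n : ℕ in atTop, ‖a ^ n‖ ≤ 1 * ‖ρ ^ n‖ := by
    filter_upwards [(spectrum.pow_norm_pow_one_div_tendsto_nhds_spectralRadius a).eventually_lt_const
      hlt, eventually_gt_atTop 0] with n hn hn0
    rw [ENNReal.ofReal_lt_ofReal_iff hρ0] at hn
    rw [one_mul, Real.norm_of_nonneg (by positivity)]
    have := pow_le_pow_left₀ (by positivity) hn.le n
    rwa [one_div, Real.rpow_inv_natCast_pow (norm_nonneg _) hn0.ne'] at this
  obtain ⟨K, hK, hbound⟩ := Asymptotics.bound_of_isBigO_nat_atTop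
    (Asymptotics.IsBigO.of_bound 1 hev)
  refine ⟨K, hK, fun n => ?_⟩
  simpa [abs_of_pos hρ0] using hbound (x := n) (by positivity)

theorem Matrix.linfty_opNorm_map_ofReal {m n : Type*} [Fintype m] [Fintype n]
    (A : Matrix m n ℝ) : ‖A.map (algebraMap ℝ ℂ)‖ = ‖A‖ := by
  simp [Matrix.linfty_opNorm_def]

theorem norm_Pmat_mul_pow_le {m : ℕ} (A B : Matrix (Fin m) (Fin m) ℝ) {K ρ : ℝ}
    (hK : 0 ≤ K) (hρ : 0 ≤ ρ) (hA : ∀ j, ‖A ^ j‖ ≤ K * ρ ^ j) (n j : ℕ) :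
    ‖Pmat A B n * A ^ j‖ ≤
      K * ρ ^ j * ∏ i ∈ Finset.range n, (ρ + K * ‖B‖ * ((i + 1 : ℕ) : ℝ)⁻¹) := by
  induction n generalizing j with
  | zero => simpa [Pmat] using hA j
  | succ n ih =>
    rw [Finset.prod_range_succ]
    set Q := ∏ i ∈ Finset.range n, (ρ + K * ‖B‖ * ((i + 1 : ℕ) : ℝ)⁻¹)
    set t := ((n + 1 : ℕ) : ℝ)⁻¹
    have ht : 0 ≤ t := by positivity
    have hQ : 0 ≤ Q := Finset.prod_nonneg fun _ _ => by positivity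
    have hP : ‖Pmat A B n‖ ≤ K * Q := by simpa using ih 0
    have hexp : Pmat A B (n + 1) * A ^ j =
        Pmat A B n * A ^ (j + 1) + t • (Pmat A B n * B * A ^ j) := by
      simp only [Pmat, t, pow_succ', mul_add, add_mul, mul_assoc, smul_mul_assoc, mul_smul_comm]
    calc ‖Pmat A B (n + 1) * A ^ j‖
        ≤ ‖Pmat A B n * A ^ (j + 1)‖ + ‖t • (Pmat A B n * B * A ^ j)‖ := by
          rw [hexp]; exact norm_add_le _ _
      _ ≤ K * ρ ^ (j + 1) * Q + t * (K * Q * ‖B‖ * (K * ρ ^ j)) := by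
          refine add_le_add (ih (j + 1)) ?_
          let : NormedSpace ℝ (Matrix (Fin m) (Fin m) ℝ) := Matrix.linftyOpNormedSpace
          rw [norm_smul, Real.norm_of_nonneg ht]
          have hmul := (norm_mul_le (Pmat A B n * B) (A ^ j)).trans
            (mul_le_mul_of_nonneg_right (norm_mul_le _ _) (norm_nonneg _))
          refine mul_le_mul_of_nonneg_left (hmul.trans ?_) ht
          gcongr
          exact hA j
      _ = K * ρ ^ j * (Q * (ρ + K * ‖B‖ * t)) := by ring

theorem exists_norm_Pmat_le_mul_pow {m : ℕ} (A B : Matrix (Fin m) (Fin m) ℝ) {ε : ℝ}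
    (hε : 0 < ε) : ∃ C : ℝ, 0 < C ∧ ∀ n : ℕ, ‖Pmat A B n‖ ≤
      C * ((spectralRadius ℂ (A.map (algebraMap ℝ ℂ))).toReal + ε) ^ n := by
  set s := (spectralRadius ℂ (A.map (algebraMap ℝ ℂ))).toReal
  have hs : 0 ≤ s := ENNReal.toReal_nonneg
  let : NormedAlgebra ℂ (Matrix (Fin m) (Fin m) ℂ) := Matrix.linftyOpNormedAlgebra
  have : CompleteSpace (Matrix (Fin m) (Fin m) ℂ) := FiniteDimensional.complete ℂ _
  obtain ⟨K, hK, hpow⟩ := exists_norm_pow_le_mul_pow (A.map (algebraMap ℝ ℂ))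
    (lt_add_of_pos_right s (half_pos hε))
  have hA : ∀ j, ‖A ^ j‖ ≤ K * (s + ε / 2) ^ j := fun j => by
    rw [← Matrix.linfty_opNorm_map_ofReal, Matrix.map_pow]
    exact hpow j
  have hratio : ∀ᶠ n : ℕ in atTop, s + ε / 2 + K * ‖B‖ * ((n + 1 : ℕ) : ℝ)⁻¹ ≤ s + ε := by
    have hlim : Tendsto (fun n : ℕ => s + ε / 2 + K * ‖B‖ * ((n + 1 : ℕ) : ℝ)⁻¹) atTop
        (nhds (s + ε / 2 + K * ‖B‖ * 0)) :=
      (((tendsto_inv_atTop_nhds_zero_nat (𝕜 := ℝ)).comp (tendsto_add_atTop_nat 1)).const_mul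
        _).const_add _
    exact hlim.eventually_le_const (by linarith)
  obtain ⟨C, hC, hprod⟩ := exists_le_mul_pow_of_eventually_succ_le
    (f := fun n => ∏ i ∈ Finset.range n, (s + ε / 2 + K * ‖B‖ * ((i + 1 : ℕ) : ℝ)⁻¹))
    (σ := s + ε) (by positivity) (by
      filter_upwards [hratio] with n hn
      rw [Finset.prod_range_succ]
      exact mul_le_mul_of_nonneg_left hn (Finset.prod_nonneg fun _ _ => by positivity))
  refine ⟨K * C, by positivity, fun n => ?_⟩
  have hP := norm_Pmat_mul_pow_le A B hK.le (by positivity) hA n 0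
  rw [pow_zero, pow_zero, mul_one, mul_one] at hP
  rw [mul_assoc]
  exact hP.trans (mul_le_mul_of_nonneg_left (hprod n) hK.le)

/-- A geometric bound at rate `σ` bounds the limit superior of the `n`-th roots by `σ`. -/
theorem limsup_rpow_one_div_le {f : ℕ → ℝ} {C σ : ℝ} (hf : ∀ n, 0 ≤ f n) (hC : 0 < C)
    (hσ : 0 ≤ σ) (h : ∀ n, f n ≤ C * σ ^ n) :
    limsup (fun n : ℕ => f n ^ (1 / (n : ℝ))) atTop ≤ σ := by
  have hlim : Tendsto (fun n : ℕ => C ^ (1 / (n : ℝ)) * σ) atTop (nhds σ) := by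
    have := ((Real.continuous_const_rpow hC.ne').tendsto 0).comp
      (tendsto_one_div_atTop_nhds_zero_nat (𝕜 := ℝ))
    simpa using this.mul_const σ
  rw [← hlim.limsup_eq]
  refine limsup_le_limsup ?_ ?_ hlim.isBoundedUnder_le
  · filter_upwards [eventually_gt_atTop 0] with n hn
    calc f n ^ (1 / (n : ℝ)) ≤ (C * σ ^ n) ^ (1 / (n : ℝ)) :=
          Real.rpow_le_rpow (hf n) (h n) (by positivity)
      _ = C ^ (1 / (n : ℝ)) * σ := by
          rw [Real.mul_rpow hC.le (by positivity), one_div, Real.pow_rpow_inv_natCast hσ hn.ne']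
  · exact (isBoundedUnder_of ⟨0, fun n => Real.rpow_nonneg (hf n) _⟩ :
      IsBoundedUnder (· ≥ ·) atTop _).isCoboundedUnder_le


/-- For every `ε > 0` one has `‖Pₙ(A,B)‖ ≤ C (sp(A) + ε)ⁿ` for some constant `C > 0`;
consequently `limsup ‖Pₙ(A,B)‖^{1/n} ≤ sp(A)`. -/
theorem Pmat_growth_bound {m : ℕ} (A B : Matrix (Fin m) (Fin m) ℝ) :
    (∀ ε : ℝ, 0 < ε → ∃ C : ℝ, 0 < C ∧ ∀ n : ℕ,
        ‖Pmat A B n‖ ≤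
          C * ((spectralRadius ℂ (A.map (algebraMap ℝ ℂ))).toReal + ε) ^ n) ∧
      limsup (fun n : ℕ => ‖Pmat A B n‖ ^ (1 / (n : ℝ))) atTop ≤
        (spectralRadius ℂ (A.map (algebraMap ℝ ℂ))).toReal := by
  refine ⟨fun ε hε => exists_norm_Pmat_le_mul_pow A B hε,
    le_of_forall_pos_le_add fun ε hε => ?_⟩
  obtain ⟨C, hC, hbound⟩ := exists_norm_Pmat_le_mul_pow A B hε
  exact limsup_rpow_one_div_le (fun _ => norm_nonneg _) hC
    (add_nonneg ENNReal.toReal_nonneg hε.le) hbound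
end

section
/- Let A and B be m×m real matrices with all entries nonnegative, and suppose the spectral radius sp(A) ≥ 1. Then the series ∑_{n≥0} Pₙ(A,B) diverges, i.e. the sequence (Pₙ(A,B))_{n≥0} is not summable in the space of m×m real matrices. Combined with the sufficiency of sp(A) < 1, this shows that for nonnegative A and B the condition sp(A) < 1 is necessary and sufficient for convergence of ∑_{n≥0} Pₙ(A,B). -/
open Matrix

open Filter Topology

lemma pow_apply_le_Pmat {m : ℕ} {A B : Matrix (Fin m) (Fin m) ℝ}
    (hA : ∀ i j, 0 ≤ A i j) (hB : ∀ i j, 0 ≤ B i j) (n : ℕ) (i j : Fin m) :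
    (A ^ n) i j ≤ Pmat A B n i j := by
  induction n generalizing i j with
  | zero => simp [Pmat]
  | succ k ih =>
    rw [pow_succ, Pmat, Matrix.mul_apply, Matrix.mul_apply]
    refine Finset.sum_le_sum fun l _ => mul_le_mul (ih i l) ?_ (hA l j)
      ((pow_apply_nonneg hA k i l).trans (ih i l))
    rw [Matrix.add_apply, Matrix.smul_apply, smul_eq_mul]
    exact le_add_of_nonneg_right (mul_nonneg (by positivity) (hB l j))

section

attribute [local instance] Matrix.linftyOpNormedRing Matrix.linftyOpNormedAlgebra

/-- The powers of a complex matrix of spectral radius at least one do not tend to zero. -/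
lemma Matrix.not_tendsto_pow_of_one_le_spectralRadius {m : ℕ} {M : Matrix (Fin m) (Fin m) ℂ}
    (hM : 1 ≤ spectralRadius ℂ M) : ¬ Tendsto (fun n : ℕ => M ^ n) atTop (𝓝 0) := by
  intro h
  rcases isEmpty_or_nonempty (Fin m) with _ | _
  · rw [Subsingleton.elim M 0, spectrum.spectralRadius_zero] at hM
    exact not_lt_of_ge hM zero_lt_one
  have : NormOneClass (Matrix (Fin m) (Fin m) ℂ) := Matrix.linfty_opNormOneClass
  have : CompleteSpace (Matrix (Fin m) (Fin m) ℂ) := FiniteDimensional.complete ℂ _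
  have hlt : ∀ᶠ n : ℕ in atTop, ‖M ^ n‖ < 1 :=
    (tendsto_zero_iff_norm_tendsto_zero.mp h).eventually_lt_const zero_lt_one
  obtain ⟨n, hn, hn0⟩ := (hlt.and (eventually_ne_atTop 0)).exists
  have hle : (1 : ENNReal) ≤ (‖M ^ n‖₊ : ENNReal) :=
    (one_le_pow_of_one_le' hM n).trans
      ((spectrum.spectralRadius_pow_le M n hn0).trans (spectrum.spectralRadius_le_nnnorm _))
  exact not_lt_of_ge (by exact_mod_cast hle) hn

end

/-- If `A` and `B` are entrywise nonnegative and `sp(A) ≥ 1`, then the series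
`∑_{n≥0} Pₙ(A,B)` diverges, i.e. `(Pₙ(A,B))ₙ` is not summable. -/
theorem not_summable_of_one_le_spectralRadius {m : ℕ}
    (A B : Matrix (Fin m) (Fin m) ℝ)
    (hA : ∀ i j, 0 ≤ A i j) (hB : ∀ i j, 0 ≤ B i j)
    (hsp : 1 ≤ spectralRadius ℂ (A.map (algebraMap ℝ ℂ))) :
    ¬ Summable (fun n : ℕ => Pmat A B n) := by
  intro hs
  refine Matrix.not_tendsto_pow_of_one_le_spectralRadius hsp ?_
  have hzero : Tendsto (fun n : ℕ => Pmat A B n) atTop (𝓝 0) := hs.tendsto_atTop_zero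
  refine tendsto_pi_nhds.mpr fun i => tendsto_pi_nhds.mpr fun j => ?_
  have hPij : Tendsto (fun n : ℕ => Pmat A B n i j) atTop (𝓝 0) :=
    tendsto_pi_nhds.mp (tendsto_pi_nhds.mp hzero i) j
  have hAij : Tendsto (fun n : ℕ => (A ^ n) i j) atTop (𝓝 0) :=
    squeeze_zero (fun n => pow_apply_nonneg hA n i j)
      (fun n => pow_apply_le_Pmat hA hB n i j) hPij
  have hmap : ∀ n : ℕ, (A.map (algebraMap ℝ ℂ)) ^ n = (A ^ n).map (algebraMap ℝ ℂ) := fun n =>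
    (map_pow (algebraMap ℝ ℂ).mapMatrix A n).symm
  simp only [hmap, Matrix.map_apply, Matrix.zero_apply]
  simpa [Function.comp_def] using (Complex.continuous_ofReal.tendsto 0).comp hAij
end

section
/- Let A and B be arbitrary m×m real matrices (no commutativity assumed). Then for all natural numbers n and j: binomial(n + j, n) · P_{n+j}(A, B) = Pₙ(A, B) · P_j(A, nA + B). (This is the coefficient-wise form of the identity ∂ⁿ/∂zⁿ P(z;A,B) = n! Pₙ(A,B) P(z;A,nA+B) for the matrix generating function.) -/
open Matrix

/-- Coefficient-wise form of `∂ⁿ/∂zⁿ P(z;A,B) = n! Pₙ(A,B) P(z;A,nA+B)`: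
`C(n+j, n) ⬝ P_{n+j}(A,B) = Pₙ(A,B) ⬝ P_j(A, nA+B)` for all `n`, `j`. -/
theorem choose_smul_Pmat_eq {m : ℕ} (A B : Matrix (Fin m) (Fin m) ℝ) :
    ∀ n j : ℕ,
      ((n + j).choose n : ℝ) • Pmat A B (n + j) =
        Pmat A B n * Pmat A ((n : ℝ) • A + B) j := by
  intro n j
  induction j with
  | zero => simp [Pmat]
  | succ j ih =>
    have hchoose : ((n + j).choose n : ℝ) * (n + j + 1) = (n + (j + 1)).choose n * (j + 1) := by
      have h := Nat.choose_mul_succ_eq (n + j) n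
      rw [show n + j + 1 - n = j + 1 by lia] at h
      exact_mod_cast h
    have hj : (j : ℝ) + 1 ≠ 0 := by positivity
    have hnj : (n : ℝ) + j + 1 ≠ 0 := by positivity
    have hfactor : ((n + (j + 1)).choose n : ℝ) • (A + ((n + j + 1 : ℕ) : ℝ)⁻¹ • B) =
        ((n + j).choose n : ℝ) • (A + ((j + 1 : ℕ) : ℝ)⁻¹ • ((n : ℝ) • A + B)) := by
      ext a b
      simp only [Matrix.smul_apply, Matrix.add_apply, smul_eq_mul]
      push_cast
      field_simp
      linear_combination (-((n + j + 1) * A a b + B a b)) * hchoose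
    calc ((n + (j + 1)).choose n : ℝ) • Pmat A B (n + (j + 1))
        = Pmat A B (n + j) *
            (((n + (j + 1)).choose n : ℝ) • (A + ((n + j + 1 : ℕ) : ℝ)⁻¹ • B)) := by
          rw [mul_smul_comm]; rfl
      _ = (((n + j).choose n : ℝ) • Pmat A B (n + j)) *
            (A + ((j + 1 : ℕ) : ℝ)⁻¹ • ((n : ℝ) • A + B)) := by
          rw [hfactor, mul_smul_comm, smul_mul_assoc]
      _ = Pmat A B n * Pmat A ((n : ℝ) • A + B) (j + 1) := by
          rw [ih, mul_assoc]; rfl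
end

section
/- Let A and B be m×m real matrices with spectral radius sp(A) < 1 (so that I − A is invertible and all series below converge). Then for every n ≥ 0: ∑_{j≥0} ((n+j)! / j!) · P_{n+j}(A,B) = n! · (∑_{j≥0} P_j(A,B)) · P̃ₙ, where P̃ₙ = ∏_{i=1}^{n} ((A + (1/i)B)·(I − A)⁻¹) (ordered product, i increasing from left to right). -/
open Matrix

/-- `Ptilde A B n = ∏_{i=1}^{n} ((A + (1/i) B) (I - A)⁻¹)`. -/
noncomputable def Ptilde {m : ℕ} (A B : Matrix (Fin m) (Fin m) ℝ) :
    ℕ → Matrix (Fin m) (Fin m) ℝ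
  | 0 => 1
  | k + 1 => Ptilde A B k * ((A + ((k + 1 : ℕ) : ℝ)⁻¹ • B) * (1 - A)⁻¹)

open Filter Topology

theorem summable_of_norm_add_le {E : Type*} [NormedAddCommGroup E] [CompleteSpace E]
    {f : ℕ → E} {k : ℕ} {q : ℝ} (hq : q < 1) (h : ∀ᶠ j in atTop, ‖f (j + k)‖ ≤ q * ‖f j‖) :
    Summable f := by
  obtain ⟨N, hN⟩ := eventually_atTop.1 h
  rw [← summable_nat_add_iff N]
  refine Summable.of_norm (summable_of_sum_range_le
    (c := (∑ j ∈ Finset.range k, ‖f (j + N)‖) / (1 - q)) (fun _ => norm_nonneg _) fun n => ?_)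
  rw [le_div_iff₀ (by linarith)]
  have hle : ∑ j ∈ Finset.range n, ‖f (j + N)‖ ≤ ∑ j ∈ Finset.range (k + n), ‖f (j + N)‖ :=
    Finset.sum_le_sum_of_subset_of_nonneg (Finset.range_mono (by omega))
      fun _ _ _ => norm_nonneg _
  rw [Finset.sum_range_add] at hle
  have hshift : ∑ j ∈ Finset.range n, ‖f (k + j + N)‖ ≤
      q * ∑ j ∈ Finset.range n, ‖f (j + N)‖ := by
    rw [Finset.mul_sum]
    refine Finset.sum_le_sum fun j _ => ?_
    have := hN (j + N) (by omega)
    rwa [show j + N + k = k + j + N by ring] at this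
  linarith

theorem exists_tendsto_pow_of_succ_eq_mul_s7 {R : Type*} [Monoid R] [TopologicalSpace R]
    [ContinuousMul R] {f X : ℕ → R} {a : R} (hf : ∀ j, f (j + 1) = f j * X j)
    (hX : Tendsto X atTop (𝓝 a)) (k : ℕ) :
    ∃ Y : ℕ → R, Tendsto Y atTop (𝓝 (a ^ k)) ∧ ∀ j, f (j + k) = f j * Y j := by
  induction k with
  | zero => exact ⟨fun _ => 1, by simpa using tendsto_const_nhds, by simp⟩
  | succ k ih =>
    obtain ⟨Y, hY, hfY⟩ := ih
    refine ⟨fun j => Y j * X (j + k), ?_, fun j => ?_⟩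
    · rw [pow_succ]
      exact hY.mul (hX.comp (tendsto_add_atTop_nat k))
    · rw [← add_assoc, hf, hfY, mul_assoc]

theorem summable_of_succ_eq_mul {R : Type*} [NormedRing R] [CompleteSpace R]
    {f X : ℕ → R} {a : R} (hf : ∀ j, f (j + 1) = f j * X j)
    (hX : Tendsto X atTop (𝓝 a)) (ha : Tendsto (fun k : ℕ => a ^ k) atTop (𝓝 0)) :
    Summable f := by
  obtain ⟨k, hk⟩ := (ha.norm.eventually_lt_const (u := 1) (by simp)).exists
  obtain ⟨q, hkq, hq⟩ := exists_between hk
  obtain ⟨Y, hY, hfY⟩ := exists_tendsto_pow_of_succ_eq_mul_s7 hf hX k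
  refine summable_of_norm_add_le hq (k := k) ?_
  filter_upwards [hY.norm.eventually_lt_const hkq] with j hj
  rw [hfY, mul_comm q]
  exact (norm_mul_le _ _).trans (mul_le_mul_of_nonneg_left hj.le (norm_nonneg _))

theorem tendsto_pow_zero_of_spectralRadius_lt_one {R : Type*} [NormedRing R]
    [NormedAlgebra ℂ R] [CompleteSpace R] {a : R} (ha : spectralRadius ℂ a < 1) :
    Tendsto (fun k : ℕ => a ^ k) atTop (𝓝 0) := by
  obtain ⟨q, haq, hq⟩ := ENNReal.lt_iff_exists_nnreal_btwn.1 ha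
  have hlim := spectrum.pow_nnnorm_pow_one_div_tendsto_nhds_spectralRadius a
  refine squeeze_zero_norm' (a := fun k : ℕ => (q : ℝ) ^ k) ?_
    (tendsto_pow_atTop_nhds_zero_of_lt_one q.2 (by exact_mod_cast hq))
  filter_upwards [hlim.eventually_lt_const haq, eventually_gt_atTop 0] with k hk hk0
  have h := ENNReal.rpow_le_rpow hk.le (Nat.cast_nonneg k : (0 : ℝ) ≤ k)
  rw [← ENNReal.rpow_mul, one_div_mul_cancel (by positivity), ENNReal.rpow_one,
    ENNReal.rpow_natCast] at h
  exact_mod_cast h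

section

attribute [local instance] Matrix.linftyOpNormedRing Matrix.linftyOpNormedAlgebra

theorem Matrix.tendsto_pow_zero_of_spectralRadius_lt_one {m : ℕ} {A : Matrix (Fin m) (Fin m) ℝ}
    (hA : spectralRadius ℂ (A.map (algebraMap ℝ ℂ)) < 1) :
    Tendsto (fun k : ℕ => A ^ k) atTop (𝓝 0) := by
  have h := _root_.tendsto_pow_zero_of_spectralRadius_lt_one hA
  have hre : Continuous fun M : Matrix (Fin m) (Fin m) ℂ => M.map Complex.re :=
    continuous_id.matrix_map Complex.continuous_re
  have h' := (hre.tendsto 0).comp h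
  convert h' using 1
  · ext k i j
    have := congrFun₂ (Matrix.map_pow (f := algebraMap ℝ ℂ) A k) i j
    change (A ^ k) i j = ((A.map (algebraMap ℝ ℂ) ^ k) i j).re
    rw [← this]
    simp
  · simp [Matrix.map_zero]

theorem Matrix.summable_of_succ_eq_mul {m : ℕ} {f X : ℕ → Matrix (Fin m) (Fin m) ℝ}
    {A : Matrix (Fin m) (Fin m) ℝ} (hf : ∀ j, f (j + 1) = f j * X j)
    (hX : Tendsto X atTop (𝓝 A)) (hA : Tendsto (fun k : ℕ => A ^ k) atTop (𝓝 0)) :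
    Summable f :=
  _root_.summable_of_succ_eq_mul hf hX hA

end

theorem Matrix.isUnit_one_sub_of_tendsto_pow {m : ℕ} {A : Matrix (Fin m) (Fin m) ℝ}
    (hA : Tendsto (fun k : ℕ => A ^ k) atTop (𝓝 0)) : IsUnit (1 - A) := by
  have hs : Summable fun k : ℕ => A ^ k :=
    Matrix.summable_of_succ_eq_mul (pow_succ A) tendsto_const_nhds hA
  exact ⟨⟨_, _, hs.one_sub_mul_tsum_pow, hs.tsum_pow_mul_one_sub⟩, rfl⟩

theorem smul_Pmat_succ {m : ℕ} (A B : Matrix (Fin m) (Fin m) ℝ) (k : ℕ) :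
    ((k : ℝ) + 1) • Pmat A B (k + 1) = Pmat A B k * (((k : ℝ) + 1) • A + B) := by
  have hk : (k : ℝ) + 1 ≠ 0 := by positivity
  simp [Pmat, ← mul_smul_comm, smul_smul, hk]

/-- The summand of the `n`-th derivative at `1` of the generating function of `Pmat A B`. -/
noncomputable def Mterm {m : ℕ} (A B : Matrix (Fin m) (Fin m) ℝ) (n j : ℕ) :
    Matrix (Fin m) (Fin m) ℝ :=
  (((n + j).factorial : ℝ) / (j.factorial : ℝ)) • Pmat A B (n + j)

theorem Mterm_zero_left {m : ℕ} (A B : Matrix (Fin m) (Fin m) ℝ) (j : ℕ) :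
    Mterm A B 0 j = Pmat A B j := by
  have : (j.factorial : ℝ) ≠ 0 := by positivity
  simp [Mterm, this]

theorem smul_Mterm_succ {m : ℕ} (A B : Matrix (Fin m) (Fin m) ℝ) (n j : ℕ) :
    ((j : ℝ) + 1) • Mterm A B n (j + 1) = Mterm A B (n + 1) j := by
  have hj : (j : ℝ) + 1 ≠ 0 := by positivity
  have hj' : (j.factorial : ℝ) ≠ 0 := by positivity
  rw [Mterm, Mterm, smul_smul, show n + 1 + j = n + (j + 1) by ring]
  congr 1
  rw [Nat.factorial_succ j]
  push_cast
  field_simp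

theorem Mterm_succ_left {m : ℕ} (A B : Matrix (Fin m) (Fin m) ℝ) (n j : ℕ) :
    Mterm A B (n + 1) j = Mterm A B n j * (((n : ℝ) + j + 1) • A + B) := by
  have h := smul_Pmat_succ A B (n + j)
  push_cast at h
  rw [Mterm, Mterm, smul_mul_assoc, ← h, smul_smul, show n + 1 + j = n + j + 1 by ring]
  congr 1
  rw [Nat.factorial_succ]
  push_cast
  ring

theorem Mterm_succ_right {m : ℕ} (A B : Matrix (Fin m) (Fin m) ℝ) (n j : ℕ) :
    Mterm A B n (j + 1) = Mterm A B n j *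
      (A + (1 / ((j : ℝ) + 1)) • ((n : ℝ) • A + B)) := by
  have hj : (j : ℝ) + 1 ≠ 0 := by positivity
  refine smul_right_injective _ hj ?_
  simp only [smul_Mterm_succ, Mterm_succ_left, ← mul_smul_comm, smul_add, smul_smul,
    mul_one_div_cancel hj, one_smul]
  rw [← mul_assoc, mul_one_div_cancel hj]
  congr 1
  module

theorem summable_Mterm {m : ℕ} (A B : Matrix (Fin m) (Fin m) ℝ)
    (hA : Tendsto (fun k : ℕ => A ^ k) atTop (𝓝 0)) (n : ℕ) : Summable (Mterm A B n) := by
  refine Matrix.summable_of_succ_eq_mul (Mterm_succ_right A B n) ?_ hA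
  have h := (tendsto_one_div_add_atTop_nhds_zero_nat (𝕜 := ℝ)).smul_const ((n : ℝ) • A + B)
  simpa using h.const_add A

theorem tsum_Mterm_succ_mul {m : ℕ} (A B : Matrix (Fin m) (Fin m) ℝ)
    (hA : Tendsto (fun k : ℕ => A ^ k) atTop (𝓝 0)) (n : ℕ) :
    (∑' j, Mterm A B (n + 1) j) * (1 - A) = (∑' j, Mterm A B n j) * (((n : ℝ) + 1) • A + B) := by
  have h0 := summable_Mterm A B hA n
  have h1 := summable_Mterm A B hA (n + 1)
  have hs : HasSum (fun j : ℕ => (j : ℝ) • Mterm A B n j) (∑' j, Mterm A B (n + 1) j) := by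
    rw [← hasSum_nat_add_iff' 1]
    simpa [smul_Mterm_succ] using h1.hasSum
  have key : ∀ j, Mterm A B (n + 1) j =
      (j : ℝ) • Mterm A B n j * A + Mterm A B n j * (((n : ℝ) + 1) • A + B) := fun j => by
    rw [Mterm_succ_left, smul_mul_assoc, ← mul_smul_comm, ← mul_add]
    congr 1
    module
  have h := (hs.mul_right A).add (h0.hasSum.mul_right (((n : ℝ) + 1) • A + B))
  simp only [← key] at h
  rw [mul_sub, mul_one, sub_eq_iff_eq_add', ← h.tsum_eq]

theorem tsum_Mterm {m : ℕ} (A B : Matrix (Fin m) (Fin m) ℝ)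
    (hA : Tendsto (fun k : ℕ => A ^ k) atTop (𝓝 0)) (n : ℕ) :
    ∑' j, Mterm A B n j = (n.factorial : ℝ) • ((∑' j, Pmat A B j) * Ptilde A B n) := by
  induction n with
  | zero => simp [Mterm_zero_left, Ptilde]
  | succ n ih =>
    have hdet : IsUnit (1 - A).det :=
      (Matrix.isUnit_iff_isUnit_det _).1 (Matrix.isUnit_one_sub_of_tendsto_pow hA)
    have hn : (n : ℝ) + 1 ≠ 0 := by positivity
    have hfac : ((n : ℝ) + 1) • A + B = ((n : ℝ) + 1) • (A + ((n + 1 : ℕ) : ℝ)⁻¹ • B) := by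
      simp [smul_smul, hn]
    rw [← Matrix.mul_nonsing_inv_cancel_right _ (∑' j, Mterm A B (n + 1) j) hdet,
      tsum_Mterm_succ_mul A B hA, ih, hfac, Ptilde, Nat.factorial_succ]
    push_cast
    simp only [smul_mul_assoc, mul_smul_comm, smul_smul, mul_assoc]

/-- If `sp(A) < 1` (so `I - A` is invertible and all series converge), then
`Mₙ(A,B) = n! P(1;A,B) P̃ₙ`. -/
theorem Mn_eq_factorial_P_one_mul_Ptilde {m : ℕ} (A B : Matrix (Fin m) (Fin m) ℝ)
    (hA : spectralRadius ℂ (A.map (algebraMap ℝ ℂ)) < 1) :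
    IsUnit (1 - A) ∧
      ∀ n : ℕ,
        Summable (fun j : ℕ =>
          (((n + j).factorial : ℝ) / (j.factorial : ℝ)) • Pmat A B (n + j)) ∧
        Summable (fun j : ℕ => Pmat A B j) ∧
        ∑' j : ℕ, (((n + j).factorial : ℝ) / (j.factorial : ℝ)) • Pmat A B (n + j) =
          (n.factorial : ℝ) • ((∑' j : ℕ, Pmat A B j) * Ptilde A B n) := by
  have h := Matrix.tendsto_pow_zero_of_spectralRadius_lt_one hA
  refine ⟨Matrix.isUnit_one_sub_of_tendsto_pow h, fun n => ⟨summable_Mterm A B h n, ?_,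
    tsum_Mterm A B h n⟩⟩
  exact (summable_Mterm A B h 0).congr (Mterm_zero_left A B)
end

section
/- Let A, B₁, B₂ be m×m real matrices that pairwise commute, with spectral radius sp(A) < 1. Then (∑_{n≥0} Pₙ(A,B₁)) · (∑_{n≥0} Pₙ(A,B₂)) = ∑_{n≥0} Pₙ(A, A + B₁ + B₂), all three series being convergent. -/
open Matrix

section PmatAlgebra

open Finset.HasAntidiagonal (antidiagonal mem_antidiagonal)

variable {m : ℕ} {A B : Matrix (Fin m) (Fin m) ℝ}

theorem Pmat_succ_smul (A B : Matrix (Fin m) (Fin m) ℝ) (n : ℕ) :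
    ((n : ℝ) + 1) • Pmat A B (n + 1) = Pmat A B n * (((n : ℝ) + 1) • A + B) := by
  have hn : (n : ℝ) + 1 ≠ 0 := by positivity
  rw [Pmat, ← mul_smul_comm, smul_add, smul_smul]
  push_cast
  rw [mul_inv_cancel₀ hn, one_smul]

theorem Commute.Pmat_right {C : Matrix (Fin m) (Fin m) ℝ} (hA : Commute C A)
    (hB : Commute C B) (n : ℕ) : Commute C (Pmat A B n) := by
  induction n with
  | zero => exact Commute.one_right C
  | succ n ih => exact ih.mul_right (hA.add_right (hB.smul_right _))

/-- The terms `Pmat A (A + B₁ + B₂) n` form the Cauchy product of the other two families. -/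
theorem sum_antidiagonal_Pmat_mul_Pmat {B₁ B₂ : Matrix (Fin m) (Fin m) ℝ}
    (hAB₂ : Commute A B₂) (hB : Commute B₁ B₂) (hAB₁ : Commute A B₁) (n : ℕ) :
    ∑ p ∈ antidiagonal n, Pmat A B₁ p.1 * Pmat A B₂ p.2 =
      Pmat A (A + B₁ + B₂) n := by
  induction n with
  | zero => simp [Pmat]
  | succ n ih =>
    have hn : (n : ℝ) + 1 ≠ 0 := by positivity
    refine smul_right_injective _ hn ?_
    beta_reduce
    rw [Pmat_succ_smul, ← ih, Finset.smul_sum, Finset.sum_mul]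
    have hsplit : ∑ p ∈ antidiagonal (n + 1),
          ((n : ℝ) + 1) • (Pmat A B₁ p.1 * Pmat A B₂ p.2) =
        ∑ p ∈ antidiagonal (n + 1), ((p.1 : ℝ) • Pmat A B₁ p.1) * Pmat A B₂ p.2 +
        ∑ p ∈ antidiagonal (n + 1), Pmat A B₁ p.1 * ((p.2 : ℝ) • Pmat A B₂ p.2) := by
      rw [← Finset.sum_add_distrib]
      refine Finset.sum_congr rfl fun p hp => ?_
      have hp' : (p.1 : ℝ) + p.2 = n + 1 := by exact_mod_cast mem_antidiagonal.mp hp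
      rw [smul_mul_assoc, mul_smul_comm, ← add_smul, hp']
    rw [hsplit, Finset.Nat.sum_antidiagonal_succ, Finset.Nat.sum_antidiagonal_succ']
    simp only [Nat.cast_zero, zero_smul, zero_mul, mul_zero, zero_add, Nat.cast_add,
      Nat.cast_one, Pmat_succ_smul]
    rw [← Finset.sum_add_distrib]
    refine Finset.sum_congr rfl fun p hp => ?_
    have hp' : (p.1 : ℝ) + p.2 = n := by exact_mod_cast mem_antidiagonal.mp hp
    have hc : Commute (((p.1 : ℝ) + 1) • A + B₁) (Pmat A B₂ p.2) :=
      (((Commute.refl A).smul_left _).add_left hAB₁.symm).Pmat_right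
        ((hAB₂.smul_left _).add_left hB) p.2
    rw [mul_assoc, hc.eq, ← mul_assoc, ← mul_assoc, ← mul_add, ← hp']
    congr 1
    module

end PmatAlgebra

/-- A nonnegative sequence which contracts geometrically along a fixed step is summable. -/
theorem summable_of_add_le_mul {u : ℕ → ℝ} {r : ℝ} {N : ℕ} (hu : ∀ n, 0 ≤ u n) (hr : r < 1)
    (h : ∀ n, u (n + N) ≤ r * u n) : Summable u := by
  refine summable_of_sum_range_le (c := (∑ i ∈ Finset.range N, u i) / (1 - r)) hu fun M => ?_
  rw [le_div_iff₀ (by linarith)]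
  have h₁ : ∑ i ∈ Finset.range M, u i ≤ ∑ i ∈ Finset.range (N + M), u i :=
    Finset.sum_le_sum_of_subset_of_nonneg (Finset.range_mono (by omega)) fun i _ _ => hu i
  have h₂ : ∑ i ∈ Finset.range M, u (N + i) ≤ r * ∑ i ∈ Finset.range M, u i := by
    rw [Finset.mul_sum]
    exact Finset.sum_le_sum fun i _ => add_comm N i ▸ h i
  rw [Finset.sum_range_add] at h₁
  linarith

theorem exists_nnnorm_pow_lt_one_of_spectralRadius_lt_one {R : Type*} [NormedRing R]
    [NormedAlgebra ℂ R] [CompleteSpace R] {a : R} (ha : spectralRadius ℂ a < 1) :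
    ∃ n : ℕ, ‖a ^ n‖₊ < 1 := by
  have h := spectrum.pow_nnnorm_pow_one_div_tendsto_nhds_spectralRadius a
  obtain ⟨n, hn, hpos⟩ :=
    ((h.eventually_lt_const ha).and (Filter.eventually_gt_atTop 0)).exists
  refine ⟨n, ?_⟩
  by_contra! hle
  exact hn.not_ge (ENNReal.one_le_rpow (by exact_mod_cast hle) (by positivity))

theorem exists_Pmat_add_eq_mul {m : ℕ} (A B : Matrix (Fin m) (Fin m) ℝ) (N : ℕ) :
    ∃ T : ℕ → Matrix (Fin m) (Fin m) ℝ, (∀ n, Pmat A B (n + N) = Pmat A B n * T n) ∧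
      Filter.Tendsto T Filter.atTop (nhds (A ^ N)) := by
  induction N with
  | zero => exact ⟨fun _ => 1, fun n => by simp, by simp⟩
  | succ N ih =>
    obtain ⟨T, hT, hlim⟩ := ih
    refine ⟨fun n => T n * (A + ((n + N + 1 : ℕ) : ℝ)⁻¹ • B), fun n => ?_, ?_⟩
    · rw [← add_assoc, Pmat, hT, mul_assoc]
    · have hinv : Filter.Tendsto (fun n : ℕ => ((n + N + 1 : ℕ) : ℝ)⁻¹) Filter.atTop (nhds 0) :=
        (Filter.tendsto_add_atTop_iff_nat (N + 1)).mpr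
          (tendsto_inv_atTop_nhds_zero_nat (𝕜 := ℝ))
      have h := hlim.mul ((tendsto_const_nhds (x := A)).add (hinv.smul_const B))
      rwa [zero_smul, add_zero, ← pow_succ] at h

section PmatNorm

open scoped Matrix.Norms.Operator
open Finset.HasAntidiagonal (antidiagonal)

theorem linfty_opNNNorm_map_ofReal {m : ℕ} (A : Matrix (Fin m) (Fin m) ℝ) :
    ‖A.map (algebraMap ℝ ℂ)‖₊ = ‖A‖₊ := by
  simp [Matrix.linfty_opNNNorm_def]

theorem summable_norm_Pmat {m : ℕ} {A : Matrix (Fin m) (Fin m) ℝ}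
    (hA : spectralRadius ℂ (A.map (algebraMap ℝ ℂ)) < 1) (B : Matrix (Fin m) (Fin m) ℝ) :
    Summable fun n => ‖Pmat A B n‖ := by
  obtain ⟨N, hN⟩ := exists_nnnorm_pow_lt_one_of_spectralRadius_lt_one hA
  rw [← Matrix.map_pow, linfty_opNNNorm_map_ofReal] at hN
  obtain ⟨T, hT, hlim⟩ := exists_Pmat_add_eq_mul A B N
  obtain ⟨r, hr₀, hr⟩ := exists_between (show ‖A ^ N‖ < 1 from hN)
  obtain ⟨k, hk⟩ := Filter.eventually_atTop.mp (hlim.norm.eventually_lt_const hr₀)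
  rw [← summable_nat_add_iff k]
  refine summable_of_add_le_mul (N := N) (fun n => norm_nonneg _) hr fun n => ?_
  rw [add_right_comm, hT, mul_comm r]
  exact (norm_mul_le _ _).trans
    (mul_le_mul_of_nonneg_left (hk _ (Nat.le_add_left k n)).le (norm_nonneg _))

theorem summable_Pmat {m : ℕ} {A : Matrix (Fin m) (Fin m) ℝ}
    (hA : spectralRadius ℂ (A.map (algebraMap ℝ ℂ)) < 1) (B : Matrix (Fin m) (Fin m) ℝ) :
    Summable (Pmat A B) :=
  (summable_norm_Pmat hA B).of_norm

theorem tsum_Pmat_mul_tsum_Pmat_eq_tsum_antidiagonal {m : ℕ} {A : Matrix (Fin m) (Fin m) ℝ}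
    (hA : spectralRadius ℂ (A.map (algebraMap ℝ ℂ)) < 1)
    (B₁ B₂ : Matrix (Fin m) (Fin m) ℝ) :
    (∑' n, Pmat A B₁ n) * (∑' n, Pmat A B₂ n) =
      ∑' n, ∑ p ∈ antidiagonal n, Pmat A B₁ p.1 * Pmat A B₂ p.2 :=
  tsum_mul_tsum_eq_tsum_sum_antidiagonal_of_summable_norm (summable_norm_Pmat hA B₁)
    (summable_norm_Pmat hA B₂)

end PmatNorm

/-- For pairwise commuting `A`, `B₁`, `B₂` with `sp(A) < 1`:
`P(1;A,B₁) P(1;A,B₂) = P(1;A, A+B₁+B₂)`, all three series converging. -/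
theorem tsum_Pmat_mul_tsum_Pmat {m : ℕ} (A B₁ B₂ : Matrix (Fin m) (Fin m) ℝ)
    (hAB₁ : A * B₁ = B₁ * A) (hAB₂ : A * B₂ = B₂ * A) (hB : B₁ * B₂ = B₂ * B₁)
    (hA : spectralRadius ℂ (A.map (algebraMap ℝ ℂ)) < 1) :
    Summable (fun n : ℕ => Pmat A B₁ n) ∧
    Summable (fun n : ℕ => Pmat A B₂ n) ∧
    Summable (fun n : ℕ => Pmat A (A + B₁ + B₂) n) ∧
    (∑' n : ℕ, Pmat A B₁ n) * (∑' n : ℕ, Pmat A B₂ n) =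
      ∑' n : ℕ, Pmat A (A + B₁ + B₂) n := by
  refine ⟨summable_Pmat hA B₁, summable_Pmat hA B₂, summable_Pmat hA _, ?_⟩
  rw [tsum_Pmat_mul_tsum_Pmat_eq_tsum_antidiagonal hA]
  exact tsum_congr (sum_antidiagonal_Pmat_mul_Pmat hAB₂ hB hAB₁)
end

section
/- Let A and B be m×m real matrices that commute (AB = BA), with spectral radius sp(A) < 1, and let β be a row vector of size m. Then for every n ≥ 0, the n-th factorial moment of the sequence p_j = β P_j(A,B) 𝟙 satisfies ∑_{j≥0} ((n+j)! / j!) · β P_{n+j}(A,B) 𝟙 = n! · β · (∑_{j≥0} P_j(A,B)) · ((I − A)⁻¹)ⁿ · Pₙ(A,B) · 𝟙, where 𝟙 is the all-ones column vector of size m. -/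
open Matrix

section

open Filter Topology
open scoped Matrix.Norms.Operator ENNReal

/-- Powers of a real matrix with complex spectral radius below one decay geometrically. -/
theorem exists_norm_pow_le_of_spectralRadius_lt_one {m : ℕ} {A : Matrix (Fin m) (Fin m) ℝ}
    (hA : spectralRadius ℂ (A.map (algebraMap ℝ ℂ)) < 1) :
    ∃ r : ℝ, 0 < r ∧ r < 1 ∧ ∃ C : ℝ, 0 < C ∧ ∀ k : ℕ, ‖A ^ k‖ ≤ C * r ^ k := by
  obtain ⟨r, hr, hr1⟩ := ENNReal.lt_iff_exists_nnreal_btwn.1 hA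
  have hr1' : r < 1 := by exact_mod_cast hr1
  have hr0 : 0 < r := by exact_mod_cast pos_of_gt hr
  have hmap (k : ℕ) : ‖A.map (algebraMap ℝ ℂ) ^ k‖ = ‖A ^ k‖ := by
    have : A.map (algebraMap ℝ ℂ) ^ k = (A ^ k).map (algebraMap ℝ ℂ) :=
      (map_pow (algebraMap ℝ ℂ).mapMatrix A k).symm
    rw [this, Matrix.linfty_opNorm_def, Matrix.linfty_opNorm_def]
    simp
  have hlim := spectrum.pow_nnnorm_pow_one_div_tendsto_nhds_spectralRadius
    (A.map (algebraMap ℝ ℂ))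
  have hbig : (fun k : ℕ => A ^ k) =O[atTop] fun k => (r : ℝ) ^ k := by
    refine Asymptotics.IsBigO.of_bound 1 ?_
    filter_upwards [hlim.eventually_lt_const hr, eventually_gt_atTop 0] with k hk hk0
    have hk0' : (0 : ℝ) < k := by exact_mod_cast hk0
    have h := ENNReal.rpow_le_rpow hk.le hk0'.le
    rw [← ENNReal.rpow_mul, one_div, inv_mul_cancel₀ hk0'.ne', ENNReal.rpow_one,
      ENNReal.rpow_natCast] at h
    have h' : ‖A.map (algebraMap ℝ ℂ) ^ k‖₊ ≤ r ^ k := by exact_mod_cast h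
    rw [one_mul, ← hmap, Real.norm_of_nonneg (by positivity)]
    exact_mod_cast h'
  obtain ⟨C, hC, hbound⟩ := Asymptotics.bound_of_isBigO_nat_atTop hbig
  refine ⟨r, hr0, hr1', C, hC, fun k => ?_⟩
  have hpos : (0 : ℝ) < (r : ℝ) ^ k := pow_pos (by exact_mod_cast hr0) k
  simpa [abs_of_pos hpos] using hbound hpos.ne'

theorem Pmat_mul_pow_norm_le {m : ℕ} {A B : Matrix (Fin m) (Fin m) ℝ} (hAB : A * B = B * A)
    {r C : ℝ} (hr : 0 < r) (hC : 0 < C) (hpow : ∀ k : ℕ, ‖A ^ k‖ ≤ C * r ^ k) (n k : ℕ) :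
    ‖Pmat A B n * A ^ k‖ ≤ C * r ^ k * ∏ i ∈ Finset.range n, (r + ‖B‖ / (i + 1)) := by
  induction n generalizing k with
  | zero => simpa [Pmat] using hpow k
  | succ n ih =>
    have hcomm : B * A ^ k = A ^ k * B := ((show Commute A B from hAB).pow_left k).eq.symm
    have hsplit : Pmat A B (n + 1) * A ^ k =
        Pmat A B n * A ^ (k + 1) + ((n : ℝ) + 1)⁻¹ • (Pmat A B n * A ^ k * B) := by
      simp only [Pmat, mul_assoc, add_mul, mul_add, smul_mul_assoc, mul_smul_comm, hcomm, pow_succ',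
        Nat.cast_add, Nat.cast_one]
    rw [hsplit, Finset.prod_range_succ]
    set p := ∏ i ∈ Finset.range n, (r + ‖B‖ / ((i : ℝ) + 1))
    calc ‖Pmat A B n * A ^ (k + 1) + ((n : ℝ) + 1)⁻¹ • (Pmat A B n * A ^ k * B)‖
        ≤ ‖Pmat A B n * A ^ (k + 1)‖ + ((n : ℝ) + 1)⁻¹ * (‖Pmat A B n * A ^ k‖ * ‖B‖) := by
          refine (norm_add_le _ _).trans ?_
          rw [norm_smul, Real.norm_of_nonneg (by positivity)]
          gcongr
          exact norm_mul_le _ _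
      _ ≤ C * r ^ (k + 1) * p + ((n : ℝ) + 1)⁻¹ * (C * r ^ k * p * ‖B‖) := by
          gcongr
          · exact ih (k + 1)
          · exact ih k
      _ = C * r ^ k * (p * (r + ‖B‖ / (n + 1))) := by
          rw [div_eq_inv_mul]; ring

theorem summable_factorial_div_mul_prod {r b : ℝ} (hr : 0 < r) (hr1 : r < 1) (hb : 0 ≤ b) (n : ℕ) :
    Summable fun j : ℕ => ((n + j).factorial : ℝ) / j.factorial *
      ∏ i ∈ Finset.range (n + j), (r + b / (i + 1)) := by
  have hpos (j : ℕ) : 0 < ((n + j).factorial : ℝ) / j.factorial *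
      ∏ i ∈ Finset.range (n + j), (r + b / (i + 1)) :=
    mul_pos (by positivity) (Finset.prod_pos fun i _ => by positivity)
  refine summable_of_ratio_test_tendsto_lt_one hr1 (.of_forall fun j => (hpos j).ne') ?_
  have hcast : Tendsto (fun j : ℕ => (j : ℝ) + 1) atTop atTop :=
    tendsto_atTop_add_const_right _ _ tendsto_natCast_atTop_atTop
  have hcast' : Tendsto (fun j : ℕ => (n : ℝ) + j + 1) atTop atTop := by
    simpa only [add_assoc] using tendsto_atTop_add_const_left _ (n : ℝ) hcast
  have hlim : Tendsto (fun j : ℕ => (1 + n / ((j : ℝ) + 1)) * (r + b / ((n : ℝ) + j + 1)))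
      atTop (𝓝 r) := by
    simpa using ((hcast.const_div_atTop (n : ℝ)).const_add 1).mul
      ((hcast'.const_div_atTop b).const_add r)
  refine hlim.congr fun j => ?_
  rw [Real.norm_of_nonneg (hpos _).le, Real.norm_of_nonneg (hpos _).le, eq_div_iff (hpos j).ne',
    ← add_assoc, Finset.prod_range_succ, Nat.factorial_succ, Nat.factorial_succ]
  push_cast
  field_simp
  ring

theorem summable_factorial_smul_Pmat {m : ℕ} {A B : Matrix (Fin m) (Fin m) ℝ}
    (hAB : A * B = B * A) (hA : spectralRadius ℂ (A.map (algebraMap ℝ ℂ)) < 1) (n : ℕ) :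
    Summable fun j : ℕ => (((n + j).factorial : ℝ) / j.factorial) • Pmat A B (n + j) := by
  obtain ⟨r, hr, hr1, C, hC, hpow⟩ := exists_norm_pow_le_of_spectralRadius_lt_one hA
  refine .of_norm_bounded
    ((summable_factorial_div_mul_prod hr hr1 (norm_nonneg B) n).mul_left C) fun j => ?_
  rw [norm_smul, Real.norm_of_nonneg (by positivity), mul_left_comm]
  gcongr
  simpa using Pmat_mul_pow_norm_le hAB hr hC hpow (n + j) 0

theorem isUnit_one_sub_of_spectralRadius_lt_one {m : ℕ} {A : Matrix (Fin m) (Fin m) ℝ}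
    (hA : spectralRadius ℂ (A.map (algebraMap ℝ ℂ)) < 1) : IsUnit (1 - A) := by
  obtain ⟨r, hr, hr1, C, -, hpow⟩ := exists_norm_pow_le_of_spectralRadius_lt_one hA
  have hs : Summable (A ^ ·) :=
    .of_norm_bounded ((summable_geometric_of_lt_one hr.le hr1).mul_left C) hpow
  exact ⟨⟨1 - A, _, hs.one_sub_mul_tsum_pow, hs.tsum_pow_mul_one_sub⟩, rfl⟩

end

theorem commute_Pmat {m : ℕ} {A B X : Matrix (Fin m) (Fin m) ℝ} (hXA : Commute X A)
    (hXB : Commute X B) (n : ℕ) : Commute X (Pmat A B n) := by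
  induction n with
  | zero => exact Commute.one_right X
  | succ n ih => exact ih.mul_right (hXA.add_right (hXB.smul_right _))

theorem tsum_factorial_smul_Pmat_succ {m : ℕ} {A B : Matrix (Fin m) (Fin m) ℝ}
    (hAB : A * B = B * A) (hA : spectralRadius ℂ (A.map (algebraMap ℝ ℂ)) < 1) (n : ℕ) :
    (∑' j : ℕ, (((n + 1 + j).factorial : ℝ) / j.factorial) • Pmat A B (n + 1 + j)) * (1 - A) =
      ((n : ℝ) + 1) • ((∑' j : ℕ, (((n + j).factorial : ℝ) / j.factorial) • Pmat A B (n + j)) *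
        (A + ((n + 1 : ℕ) : ℝ)⁻¹ • B)) := by
  set T : ℕ → ℕ → Matrix (Fin m) (Fin m) ℝ :=
    fun n j => (((n + j).factorial : ℝ) / j.factorial) • Pmat A B (n + j) with hT
  have hsum (n : ℕ) : Summable (T n) := summable_factorial_smul_Pmat hAB hA n
  change (∑' j, T (n + 1) j) * (1 - A) = ((n : ℝ) + 1) • ((∑' j, T n j) * _)
  have hshift (j : ℕ) : ((j + 1 : ℕ) : ℝ) • T n (j + 1) = T (n + 1) j := by
    simp only [hT, smul_smul, show n + (j + 1) = n + 1 + j by ring]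
    congr 1
    rw [Nat.factorial_succ j]
    push_cast
    field_simp
  have hstep (j : ℕ) : T (n + 1) j =
      T n j * (((n : ℝ) + 1) • A + B) + ((j : ℝ) • T n j) * A := by
    have hn : ((n : ℝ) + j + 1) ≠ 0 := by positivity
    have hfactor : ((n : ℝ) + j + 1) • (A + ((n + j + 1 : ℕ) : ℝ)⁻¹ • B) =
        ((n : ℝ) + 1) • A + B + (j : ℝ) • A := by
      rw [smul_add, smul_smul]
      push_cast
      rw [mul_inv_cancel₀ hn]
      module
    have : T (n + 1) j = T n j * (((n : ℝ) + j + 1) • (A + ((n + j + 1 : ℕ) : ℝ)⁻¹ • B)) := by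
      simp only [hT, show n + 1 + j = n + j + 1 by ring, Pmat, Nat.factorial_succ,
        mul_smul_comm, smul_mul_assoc, smul_smul]
      congr 1
      push_cast
      ring
    rw [this, hfactor, mul_add, mul_smul_comm, smul_mul_assoc (j : ℝ)]
  have hj : HasSum (fun j : ℕ => (j : ℝ) • T n j) (∑' j, T (n + 1) j) := by
    rw [← hasSum_nat_add_iff' 1]
    simpa only [Finset.sum_range_one, Nat.cast_zero, zero_smul, sub_zero, hshift] using
      (hsum (n + 1)).hasSum
  have hS : ∑' j, T (n + 1) j =
      (∑' j, T n j) * (((n : ℝ) + 1) • A + B) + (∑' j, T (n + 1) j) * A := by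
    refine HasSum.unique (hsum (n + 1)).hasSum ?_
    exact (((hsum n).hasSum.mul_right _).add (hj.mul_right A)).congr_fun hstep
  have hn : ((n : ℝ) + 1) ≠ 0 := by positivity
  rw [mul_sub, mul_one, sub_eq_iff_eq_add, ← mul_smul_comm, smul_add, smul_smul]
  push_cast
  rw [mul_inv_cancel₀ hn, one_smul]
  exact hS

theorem tsum_factorial_smul_Pmat {m : ℕ} {A B : Matrix (Fin m) (Fin m) ℝ}
    (hAB : A * B = B * A) (hA : spectralRadius ℂ (A.map (algebraMap ℝ ℂ)) < 1) (n : ℕ) :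
    ∑' j : ℕ, (((n + j).factorial : ℝ) / j.factorial) • Pmat A B (n + j) =
      (n.factorial : ℝ) • ((∑' j : ℕ, Pmat A B j) * ((1 - A)⁻¹) ^ n * Pmat A B n) := by
  have hA1 := isUnit_one_sub_of_spectralRadius_lt_one hA
  have hunit := (Matrix.isUnit_iff_isUnit_det _).1 hA1
  have hinv : ∀ X, Commute X A → Commute (1 - A)⁻¹ X := fun X hX => by
    have h : Commute (1 - A) X := (Commute.one_left X).sub_left hX.symm
    obtain ⟨u, hu⟩ := hA1
    rw [← hu] at h ⊢
    rw [← Matrix.coe_units_inv]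
    exact h.units_inv_left
  induction n with
  | zero =>
    have h (j : ℕ) : ((j.factorial : ℝ) / j.factorial) = 1 := div_self (by positivity)
    simp [Pmat, h]
  | succ n ih =>
    have hc : Commute (1 - A)⁻¹ (Pmat A B (n + 1)) :=
      commute_Pmat (hinv A (Commute.refl A)) (hinv B hAB.symm) _
    have h := congrArg (· * (1 - A)⁻¹) (tsum_factorial_smul_Pmat_succ hAB hA n)
    simp only [mul_assoc, Matrix.mul_nonsing_inv _ hunit, mul_one, ih] at h
    rw [h, pow_succ, Nat.factorial_succ, mul_assoc, mul_assoc, hc.eq, Pmat]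
    simp only [smul_mul_assoc, smul_smul, mul_assoc]
    push_cast
    rfl

/-- For commuting `A`, `B` with `sp(A) < 1`, the `n`-th factorial moment of the
sequence `p_j = β P_j(A,B) 𝟙` is `mₙ = n! β P(1;A,B) (I-A)^{-n} Pₙ(A,B) 𝟙`. -/
theorem factorial_moment_commuting {m : ℕ} (A B : Matrix (Fin m) (Fin m) ℝ)
    (β : Fin m → ℝ) (hAB : A * B = B * A)
    (hA : spectralRadius ℂ (A.map (algebraMap ℝ ℂ)) < 1) :
    ∀ n : ℕ,
      Summable (fun j : ℕ =>
        (((n + j).factorial : ℝ) / (j.factorial : ℝ)) *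
          (β ⬝ᵥ (Pmat A B (n + j) *ᵥ (fun _ => (1 : ℝ))))) ∧
      Summable (fun j : ℕ => Pmat A B j) ∧
      ∑' j : ℕ, (((n + j).factorial : ℝ) / (j.factorial : ℝ)) *
          (β ⬝ᵥ (Pmat A B (n + j) *ᵥ (fun _ => (1 : ℝ)))) =
        (n.factorial : ℝ) *
          (β ⬝ᵥ (((∑' j : ℕ, Pmat A B j) * ((1 - A)⁻¹) ^ n * Pmat A B n) *ᵥ
            (fun _ => (1 : ℝ)))) := by
  intro n
  let φ : Matrix (Fin m) (Fin m) ℝ →ₗ[ℝ] ℝ :=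
    { toFun := fun M => β ⬝ᵥ (M *ᵥ fun _ => 1)
      map_add' := fun M N => by rw [Matrix.add_mulVec, dotProduct_add]
      map_smul' := fun c M => by rw [Matrix.smul_mulVec, dotProduct_smul, RingHom.id_apply] }
  have hφ : Continuous φ := by
    change Continuous fun M : Matrix (Fin m) (Fin m) ℝ => β ⬝ᵥ (M *ᵥ fun _ => 1)
    fun_prop
  have hsum := (summable_factorial_smul_Pmat hAB hA n).hasSum.map φ hφ
  have hcomp : (φ ∘ fun j : ℕ => (((n + j).factorial : ℝ) / j.factorial) • Pmat A B (n + j)) =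
      fun j : ℕ => (((n + j).factorial : ℝ) / (j.factorial : ℝ)) *
        (β ⬝ᵥ (Pmat A B (n + j) *ᵥ (fun _ => (1 : ℝ)))) :=
    funext fun j => φ.map_smul _ _
  rw [hcomp] at hsum
  refine ⟨hsum.summable, ?_, ?_⟩
  · refine (summable_factorial_smul_Pmat hAB hA 0).congr fun j => ?_
    rw [zero_add, div_self (by positivity), one_smul]
  · rw [hsum.tsum_eq, tsum_factorial_smul_Pmat hAB hA n]
    exact φ.map_smul _ _
end
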